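/- arXiv:1603.04517 — 6 statements merged into one kernel-verified Lean document; each statement's English description precedes it below -/
import Mathlib

section
/- For every integer l ≥ 1, the derivative at t = 1 of the skew-growth function of type A_l satisfies N'_{A_l}(1) = Σ_{J ⊆ {1,...,l}} (-1)^{#J} · deg_A(J) = (-1)^l. -/
open scoped Classical

/-- Adjacency for the type `A_l` Coxeter graph (the path `1—2—⋯—l`). -/
def adjA (a b : ℕ) : Prop := b = a + 1

/-- Adjacency for the type `D_l` Coxeter graph on `{1,…,l}`: edges `{i, i+1}` for
`1 ≤ i ≤ l-2` together with the edge `{l-2, l}` (so `l-1` and `l` are not adjacent). -/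
def adjD (l : ℕ) (a b : ℕ) : Prop :=
  (b = a + 1 ∧ a ≠ l - 1) ∨ (a = l - 2 ∧ b = l)

/-- The vertex sets of the connected components of the graph induced on the finite
set `J` by the (symmetrized) adjacency relation `r`. -/
noncomputable def componentsOf (r : ℕ → ℕ → Prop) (J : Finset ℕ) : Finset (Finset ℕ) :=
  J.image fun x =>
    J.filter fun y =>
      Relation.ReflTransGen (fun a b => a ∈ J ∧ b ∈ J ∧ (r a b ∨ r b a)) x y

/-- The number of maximal blocks of consecutive integers in `J`
(the connected components of the induced subgraph of the path graph). -/
noncomputable def kA (J : Finset ℕ) : ℕ := (componentsOf adjA J).card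

/-- The degree of the fundamental element of the Artin monoid of type `A_l`
associated to `J`: the sum over the maximal consecutive blocks `B` of `J`
of `binom(#B + 1, 2)`. -/
noncomputable def degA (J : Finset ℕ) : ℕ :=
  ∑ B ∈ componentsOf adjA J, (B.card + 1).choose 2

/-- The degree of the fundamental element of the Artin monoid of type `B_l`
associated to `J`: the sum over the maximal consecutive blocks `B` of `J` of
`(#B)^2` if `{1,2} ⊆ B` and `binom(#B + 1, 2)` otherwise. -/
noncomputable def degB (J : Finset ℕ) : ℕ :=
  ∑ B ∈ componentsOf adjA J,
    if 1 ∈ B ∧ 2 ∈ B then B.card ^ 2 else (B.card + 1).choose 2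

/-- The degree of the fundamental element of the Artin monoid of type `D_l`
associated to `J`: the sum over the connected components `C` of the induced
subgraph of the type `D_l` Coxeter graph on `J` of `#C·(#C - 1)` if
`{l-1, l} ⊆ C` and `binom(#C + 1, 2)` otherwise. -/
noncomputable def degD (l : ℕ) (J : Finset ℕ) : ℕ :=
  ∑ C ∈ componentsOf (adjD l) J,
    if l - 1 ∈ C ∧ l ∈ C then C.card * (C.card - 1) else (C.card + 1).choose 2

/-- Connection in the induced path graph forces all intermediate integers to lie in `J`. -/
lemma conn_iff (J : Finset ℕ) (x y : ℕ) (hx : x ∈ J) :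
    Relation.ReflTransGen (fun a b => a ∈ J ∧ b ∈ J ∧ (adjA a b ∨ adjA b a)) x y ↔
      ∀ z, min x y ≤ z → z ≤ max x y → z ∈ J := by
  constructor
  · intro h
    induction h with
    | refl =>
      intro z h1 h2
      have : z = x := by simp at h1 h2; omega
      exact this ▸ hx
    | @tail b c hb hbc ih =>
      intro z h1 h2
      obtain ⟨hbJ, hcJ, h⟩ := hbc
      by_cases hz : z = c
      · exact hz ▸ hcJ
      · unfold adjA at h
        apply ih <;> omega
  · have up : ∀ n x, (∀ z, x ≤ z → z ≤ x + n → z ∈ J) →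
        Relation.ReflTransGen (fun a b => a ∈ J ∧ b ∈ J ∧ (adjA a b ∨ adjA b a)) x (x + n) := by
      intro n
      induction n with
      | zero => intro x _; exact Relation.ReflTransGen.refl
      | succ n ih =>
        intro x h
        refine Relation.ReflTransGen.tail (ih x fun z h1 h2 => h z h1 (by omega)) ?_
        exact ⟨h _ (by omega) (by omega), h _ (by omega) (by omega), Or.inl rfl⟩
    intro h
    rcases le_total x y with hxy | hxy
    · obtain ⟨n, rfl⟩ := Nat.exists_eq_add_of_le hxy
      exact up n x fun z h1 h2 => h z (by omega) (by omega)
    · obtain ⟨n, rfl⟩ := Nat.exists_eq_add_of_le hxy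
      have hup := up n y fun z h1 h2 => h z (by omega) (by omega)
      have : Std.Symm (fun a b => a ∈ J ∧ b ∈ J ∧ (adjA a b ∨ adjA b a)) :=
        ⟨fun a b ⟨h1, h2, h3⟩ => ⟨h2, h1, h3.symm⟩⟩
      exact Relation.ReflTransGen.stdSymm.symm _ _ hup

/-- The number of weakly ordered pairs in a finite set. -/
lemma card_pairs (B : Finset ℕ) :
    ((B ×ˢ B).filter fun p => p.1 ≤ p.2).card = (B.card + 1).choose 2 := by
  induction B using Finset.induction_on_max with
  | empty => simp
  | insert m B hm ih =>
    have hmB : m ∉ B := fun h => lt_irrefl _ (hm m h)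
    have : ((insert m B ×ˢ insert m B).filter fun p => p.1 ≤ p.2) =
        ((B ×ˢ B).filter fun p => p.1 ≤ p.2) ∪ (insert m B).image fun a => (a, m) := by
      ext ⟨a, b⟩
      simp only [Finset.mem_filter, Finset.mem_product, Finset.mem_insert, Finset.mem_union,
        Finset.mem_image, Prod.mk.injEq]
      constructor
      · rintro ⟨⟨ha, hb⟩, hab⟩
        rcases hb with rfl | hb
        · exact Or.inr ⟨a, ha, rfl, rfl⟩
        · rcases ha with rfl | ha
          · have := hm b hb; omega
          · exact Or.inl ⟨⟨ha, hb⟩, hab⟩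
      · rintro (⟨⟨ha, hb⟩, hab⟩ | ⟨c, hc, rfl, rfl⟩)
        · exact ⟨⟨Or.inr ha, Or.inr hb⟩, hab⟩
        · refine ⟨⟨hc, Or.inl rfl⟩, ?_⟩
          rcases hc with rfl | hc
          · exact le_rfl
          · exact (hm _ hc).le
    rw [this, Finset.card_union_of_disjoint, ih, Finset.card_image_of_injective,
      Finset.card_insert_of_notMem hmB, Nat.choose_succ_succ' (B.card + 1) 1, Nat.choose_one_right,
      add_comm]
    · intro a b h; simpa using h
    · rw [Finset.disjoint_left]
      rintro ⟨a, b⟩ h1 h2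
      simp only [Finset.mem_filter, Finset.mem_product, Finset.mem_image, Prod.mk.injEq] at h1 h2
      obtain ⟨c, _, _, rfl⟩ := h2
      exact hmB h1.1.2

/-- `degA J` counts the nonempty intervals contained in `J`. -/
lemma degA_eq (J : Finset ℕ) :
    degA J = ((J ×ˢ J).filter fun p => p.1 ≤ p.2 ∧ Finset.Icc p.1 p.2 ⊆ J).card := by
  set comp : ℕ → Finset ℕ := fun x => J.filter fun y =>
      Relation.ReflTransGen (fun a b => a ∈ J ∧ b ∈ J ∧ (adjA a b ∨ adjA b a)) x y with hcomp
  have hmem : ∀ x y, x ∈ J → (y ∈ comp x ↔ y ∈ J ∧ ∀ z, min x y ≤ z → z ≤ max x y → z ∈ J) := by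
    intro x y hx
    simp only [hcomp, Finset.mem_filter, conn_iff J x y hx]
  have heq : ∀ x y, x ∈ J → y ∈ comp x → comp y = comp x := by
    intro x y hx hy
    rw [hmem x y hx] at hy
    ext w
    rw [hmem x w hx, hmem y w hy.1]
    constructor
    · rintro ⟨h1, h2⟩
      refine ⟨h1, fun z h3 h4 => ?_⟩
      by_cases h : min x y ≤ z ∧ z ≤ max x y
      · exact hy.2 z h.1 h.2
      · apply h2 <;> omega
    · rintro ⟨h1, h2⟩
      refine ⟨h1, fun z h3 h4 => ?_⟩
      by_cases h : min x y ≤ z ∧ z ≤ max x y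
      · exact hy.2 z h.1 h.2
      · apply h2 <;> omega
  have hself : ∀ x, x ∈ J → x ∈ comp x := by
    intro x hx
    rw [hmem x x hx]
    refine ⟨hx, fun z h1 h2 => ?_⟩
    have : z = x := by omega
    exact this ▸ hx
  have hdeg : degA J = ∑ B ∈ J.image comp, (B.card + 1).choose 2 := rfl
  rw [hdeg, Finset.card_eq_sum_card_fiberwise (f := fun p => comp p.1) (t := J.image comp)]
  · refine Finset.sum_congr rfl fun B hB => ?_
    obtain ⟨x, hx, rfl⟩ := Finset.mem_image.1 hB
    rw [← card_pairs]
    congr 1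
    ext ⟨a, b⟩
    simp only [Finset.mem_filter, Finset.mem_product]
    constructor
    · rintro ⟨⟨ha, hb⟩, hab⟩
      have haJ := ((hmem x a hx).1 ha).1
      have hbJ := ((hmem x b hx).1 hb).1
      have hc := heq x a hx ha
      refine ⟨⟨⟨haJ, hbJ⟩, hab, fun z hz => ?_⟩, hc⟩
      rw [← hc, hmem a b haJ] at hb
      rw [Finset.mem_Icc] at hz
      apply hb.2 <;> omega
    · rintro ⟨⟨⟨ha, hb⟩, hab, hs⟩, hc⟩
      rw [← hc]
      refine ⟨⟨hself a ha, (hmem a b ha).2 ⟨hb, fun z h1 h2 => hs ?_⟩⟩, hab⟩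
      rw [Finset.mem_Icc]; omega
  · intro p hp
    simp only [Finset.coe_filter, Finset.mem_product, Set.mem_ofPred_eq] at hp
    exact Finset.mem_coe.2 (Finset.mem_image_of_mem _ hp.1.1)

/-- Alternating sum over the sets between `S` and `I`. -/
lemma alt_sum (S I : Finset ℕ) (h : S ⊆ I) :
    ∑ J ∈ I.powerset, (if S ⊆ J then (-1 : ℤ) ^ J.card else 0) =
      if S = I then (-1 : ℤ) ^ I.card else 0 := by
  rw [← Finset.sum_filter]
  have h1 : I.powerset.filter (fun J => S ⊆ J) = (I \ S).powerset.image (fun T => S ∪ T) := by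
    rw [← Finset.Icc_eq_image_powerset h]
    ext J; simp [and_comm]
  have hd : ∀ T ∈ (I \ S).powerset, Disjoint S T := by
    intro T hT
    exact (Finset.disjoint_sdiff).mono_right (Finset.mem_powerset.1 hT)
  rw [h1, Finset.sum_image]
  · have h2 : ∀ T ∈ (I \ S).powerset, (-1 : ℤ) ^ (S ∪ T).card = (-1) ^ S.card * (-1) ^ T.card := by
      intro T hT
      rw [Finset.card_union_of_disjoint (hd T hT), pow_add]
    rw [Finset.sum_congr rfl h2, ← Finset.mul_sum, Finset.sum_powerset_neg_one_pow_card]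
    by_cases hS : S = I
    · subst hS; simp
    · have : I \ S ≠ ∅ := fun h3 => hS (h.antisymm (Finset.sdiff_eq_empty_iff_subset.1 h3))
      simp [this, hS]
  · intro T hT T' hT' he
    have e1 := Finset.union_sdiff_cancel_left (hd T hT)
    have e2 := Finset.union_sdiff_cancel_left (hd T' hT')
    simp only at he
    rw [← e1, ← e2, he]

/-- For every integer `l ≥ 1`, the derivative at `t = 1` of the skew-growth function of
type `A_l` satisfies `N'_{A_l}(1) = Σ_{J ⊆ {1,…,l}} (-1)^{#J} · deg_A(J) = (-1)^l`. -/
theorem skew_growth_deriv_one_typeA (l : ℕ) (hl : 1 ≤ l) :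
    Polynomial.eval (1 : ℤ) (Polynomial.derivative
        (∑ J ∈ (Finset.Icc 1 l).powerset,
          (-1 : Polynomial ℤ) ^ J.card * Polynomial.X ^ degA J))
      = ∑ J ∈ (Finset.Icc 1 l).powerset, (-1 : ℤ) ^ J.card * (degA J : ℤ) ∧
    ∑ J ∈ (Finset.Icc 1 l).powerset, (-1 : ℤ) ^ J.card * (degA J : ℤ) = (-1) ^ l := by
  constructor
  · rw [Polynomial.derivative_sum, Polynomial.eval_finsetSum]
    refine Finset.sum_congr rfl fun J _ => ?_
    have : ((-1 : Polynomial ℤ) ^ J.card) = Polynomial.C ((-1 : ℤ) ^ J.card) := by simp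
    rw [this, Polynomial.derivative_C_mul]
    simp [Polynomial.derivative_X_pow]
  · set I := Finset.Icc 1 l with hI
    set P := (I ×ˢ I).filter fun p => p.1 ≤ p.2 with hP
    have h1 : ∀ J ∈ I.powerset, (-1 : ℤ) ^ J.card * (degA J : ℤ) =
        ∑ p ∈ P, if Finset.Icc p.1 p.2 ⊆ J then (-1 : ℤ) ^ J.card else 0 := by
      intro J hJ
      rw [Finset.mem_powerset] at hJ
      rw [← Finset.sum_filter, Finset.sum_const, nsmul_eq_mul, mul_comm, degA_eq]
      congr 3
      ext ⟨a, b⟩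
      simp only [hP, Finset.mem_filter, Finset.mem_product]
      constructor
      · rintro ⟨⟨ha, hb⟩, hab, hs⟩
        exact ⟨⟨⟨hJ ha, hJ hb⟩, hab⟩, hs⟩
      · rintro ⟨⟨⟨ha, hb⟩, hab⟩, hs⟩
        exact ⟨⟨hs (Finset.left_mem_Icc.2 hab), hs (Finset.right_mem_Icc.2 hab)⟩, hab, hs⟩
    rw [Finset.sum_congr rfl h1, Finset.sum_comm]
    have h2 : ∀ p ∈ P, (∑ J ∈ I.powerset,
        if Finset.Icc p.1 p.2 ⊆ J then (-1 : ℤ) ^ J.card else 0) =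
        if p = (1, l) then (-1 : ℤ) ^ l else 0 := by
      rintro ⟨a, b⟩ hp
      simp only [hP, hI, Finset.mem_filter, Finset.mem_product, Finset.mem_Icc] at hp
      rw [alt_sum _ _ (Finset.Icc_subset_Icc hp.1.1.1 hp.1.2.2)]
      have hc : I.card = l := by simp [hI]
      have : Finset.Icc a b = I ↔ (a, b) = (1, l) := by
        constructor
        · intro h
          have m1 : 1 ∈ Finset.Icc a b := by rw [h, hI]; simp; omega
          have m2 : l ∈ Finset.Icc a b := by rw [h, hI]; simp; omega
          rw [Finset.mem_Icc] at m1 m2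
          rw [Prod.mk.injEq]; omega
        · intro h
          rw [Prod.mk.injEq] at h
          rw [h.1, h.2]
      rw [hc]
      exact if_congr this rfl rfl
    rw [Finset.sum_congr rfl h2, Finset.sum_ite_eq', if_pos]
    simp [hP, hI, hl]
end

section
/- For every integer l ≥ 4, the derivative at t = 1 of the skew-growth function of type D_l satisfies N'_{D_l}(1) = Σ_{J ⊆ {1,...,l}} (-1)^{#J} · deg_D(J) = (-1)^l · (l - 2). -/
open scoped Classical

def skR (l : ℕ) (J : Finset ℕ) (a b : ℕ) : Prop := a ∈ J ∧ b ∈ J ∧ (adjD l a b ∨ adjD l b a)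

def skReach (l : ℕ) (J : Finset ℕ) (a b : ℕ) : Prop := Relation.ReflTransGen (skR l J) a b

noncomputable def skComp (l : ℕ) (J : Finset ℕ) (x : ℕ) : Finset ℕ :=
  J.filter fun y => skReach l J x y

noncomputable def skd (l : ℕ) (C : Finset ℕ) : ℕ :=
  if l - 1 ∈ C ∧ l ∈ C then C.card * (C.card - 1) else (C.card + 1).choose 2

def skP (l y : ℕ) : Finset ℕ := if y = l then (Finset.Icc 2 l).erase (l - 1) else Finset.Icc 2 y

theorem sk_components (l : ℕ) (J : Finset ℕ) :
    componentsOf (adjD l) J = J.image (skComp l J) := rfl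

theorem sk_degD (l : ℕ) (J : Finset ℕ) :
    degD l J = ∑ C ∈ J.image (skComp l J), skd l C := rfl

theorem skR_symm {l : ℕ} {J : Finset ℕ} {a b : ℕ} (h : skR l J a b) : skR l J b a :=
  ⟨h.2.1, h.1, h.2.2.symm⟩

theorem skReach_symm {l : ℕ} {J : Finset ℕ} {a b : ℕ} (h : skReach l J a b) :
    skReach l J b a := by
  induction h with
  | refl => exact Relation.ReflTransGen.refl
  | tail _ h2 ih => exact Relation.ReflTransGen.head (skR_symm h2) ih

theorem skComp_eq {l : ℕ} {J : Finset ℕ} {a b : ℕ} (h : skReach l J a b) :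
    skComp l J a = skComp l J b := by
  ext y
  simp only [skComp, Finset.mem_filter]
  constructor
  · rintro ⟨h1, h2⟩
    exact ⟨h1, (skReach_symm h).trans h2⟩
  · rintro ⟨h1, h2⟩
    exact ⟨h1, h.trans h2⟩

theorem skReach_mono {l : ℕ} {J : Finset ℕ} {a b : ℕ} (h : skReach l J a b) :
    skReach l (insert 1 J) a b := by
  refine Relation.ReflTransGen.mono (r := skR l J) ?_ _ _ h
  rintro x y ⟨h1, h2, h3⟩
  exact ⟨Finset.mem_insert_of_mem h1, Finset.mem_insert_of_mem h2, h3⟩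

theorem skReach_back {l : ℕ} (hl : 4 ≤ l) {J : Finset ℕ} (hJ : ∀ x ∈ J, 2 ≤ x) {a b : ℕ}
    (ha : a ∈ J) (h : skReach l (insert 1 J) a b) :
    (b ≠ 1 → skReach l J a b) ∧ (b = 1 → 2 ∈ J ∧ skReach l J a 2) := by
  induction h with
  | refl =>
    have := hJ a ha
    exact ⟨fun _ => Relation.ReflTransGen.refl, fun h => by omega⟩
  | @tail y z _ h2 ih =>
    obtain ⟨hy, hz, hyz⟩ := h2
    rw [Finset.mem_insert] at hy hz
    by_cases y1 : y = 1
    · subst y1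
      have h0 := ih.2 rfl
      have hz2 : z = 2 := by
        rcases hz with hz | hz
        · simp only [adjD] at hyz; omega
        · have := hJ z hz
          simp only [adjD] at hyz; omega
      subst hz2
      exact ⟨fun _ => h0.2, fun h => by omega⟩
    · have hyJ : y ∈ J := by tauto
      have h0 := ih.1 y1
      by_cases z1 : z = 1
      · subst z1
        have hy2 : y = 2 := by
          have := hJ y hyJ
          simp only [adjD] at hyz; omega
        subst hy2
        exact ⟨fun h => absurd rfl h, fun _ => ⟨hyJ, h0⟩⟩
      · exact ⟨fun _ => h0.tail ⟨hyJ, by tauto, hyz⟩, fun h => absurd h z1⟩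

/-- Reachability from the vertex `1`. -/
theorem skReach_one {l : ℕ} (hl : 4 ≤ l) {J : Finset ℕ} (hJ : J ⊆ Finset.Icc 2 l) {y : ℕ}
    (hy : y ∈ Finset.Icc 1 l) :
    (y ∈ skComp l (insert 1 J) 1) ↔ skP l y ⊆ J := by
  have hJ' : ∀ x ∈ J, 2 ≤ x ∧ x ≤ l := fun x hx => Finset.mem_Icc.1 (hJ hx)
  have key : ∀ y, skP l y ⊆ J ↔ ∀ x, 2 ≤ x → x ≤ y → ¬ (y = l ∧ x = l - 1) → x ∈ J := by
    intro y
    unfold skP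
    split_ifs with h
    · subst h
      constructor
      · intro h x h1 h2 h3
        exact h (by simp; omega)
      · intro h x hx
        simp at hx
        exact h x (by omega) (by omega) (by omega)
    · constructor
      · intro h x h1 h2 h3
        exact h (by simp; omega)
      · intro h x hx
        simp at hx
        exact h x (by omega) (by omega) (by omega)
  rw [key]
  constructor
  · intro h
    have hr := (Finset.mem_filter.1 h).2
    clear hy h
    induction hr with
    | refl => intro x h1 h2; omega
    | @tail a b _ h2 ih =>
      obtain ⟨ha, hb, hab⟩ := h2
      intro x hx1 hx2 hx3
      have hb' : b = 1 ∨ (b ∈ J ∧ 2 ≤ b ∧ b ≤ l) := by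
        rcases Finset.mem_insert.1 hb with h | h
        · exact Or.inl h
        · exact Or.inr ⟨h, hJ' b h⟩
      by_cases hxb : x = b
      · subst hxb
        rcases hb' with h | h
        · omega
        · exact h.1
      · have ha' : a = 1 ∨ (2 ≤ a ∧ a ≤ l) := by
          rcases Finset.mem_insert.1 ha with h | h
          · exact Or.inl h
          · exact Or.inr (hJ' a h)
        simp only [adjD] at hab
        exact ih x hx1 (by omega) (by omega)
  · intro h
    have hy' := Finset.mem_Icc.1 hy
    -- vertices up to l-1
    have path : ∀ n, n + 1 ≤ l - 1 → (∀ x, 2 ≤ x → x ≤ n + 1 → x ∈ J) →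
        skReach l (insert 1 J) 1 (n + 1) := by
      intro n
      induction n with
      | zero => intro _ _; exact Relation.ReflTransGen.refl
      | succ n ih =>
        intro h1 h2
        refine (ih (by omega) (fun x hx hx' => h2 x hx (by omega))).tail ⟨?_, ?_, ?_⟩
        · by_cases hn : n = 0
          · simp [hn]
          · exact Finset.mem_insert_of_mem (h2 _ (by omega) (by omega))
        · exact Finset.mem_insert_of_mem (h2 _ (by omega) (by omega))
        · left; left; constructor
          · rfl
          · omega
    refine Finset.mem_filter.2 ⟨?_, ?_⟩
    · by_cases h1 : y = 1
      · simp [h1]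
      · exact Finset.mem_insert_of_mem (h y (by omega) le_rfl (by omega))
    · by_cases hyl : y = l
      · have h3 := path (l - 3) (by omega) (fun x h1 h2 => h x h1 (by omega) (by omega))
        refine h3.tail ⟨?_, ?_, ?_⟩
        · exact Finset.mem_insert_of_mem (h _ (by omega) (by omega) (by omega))
        · exact Finset.mem_insert_of_mem (h _ (by omega) (by omega) (by omega))
        · left; right; omega
      · have h3 := path (y - 1) (by omega) (fun x h1 h2 => h x h1 (by omega) (by omega))
        rwa [Nat.sub_add_cancel hy'.1] at h3

theorem skComp_insert {l : ℕ} (hl : 4 ≤ l) {J : Finset ℕ} (hJ : ∀ x ∈ J, 2 ≤ x) {x : ℕ}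
    (hx : x ∈ J) : skComp l J x = (skComp l (insert 1 J) x).erase 1 := by
  ext y
  simp only [skComp, Finset.mem_filter, Finset.mem_erase, Finset.mem_insert]
  constructor
  · rintro ⟨h1, h2⟩
    have := hJ y h1
    exact ⟨by omega, Or.inr h1, skReach_mono h2⟩
  · rintro ⟨h1, h2, h3⟩
    exact ⟨by tauto, (skReach_back hl hJ hx h3).1 h1⟩

theorem sk_reach12 {l : ℕ} (hl : 4 ≤ l) {J : Finset ℕ} (h2 : 2 ∈ J) :
    skReach l (insert 1 J) 1 2 :=
  Relation.ReflTransGen.single ⟨by simp, by simp [h2], by left; left; omega⟩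

theorem sk_degD_insert {l : ℕ} (hl : 4 ≤ l) {J : Finset ℕ} (hJ : ∀ x ∈ J, 2 ≤ x) :
    degD l (insert 1 J) + skd l ((skComp l (insert 1 J) 1).erase 1)
      = degD l J + skd l (skComp l (insert 1 J) 1) := by
  set C := skComp l (insert 1 J) 1 with hC
  set O := (J.image (skComp l J)).filter (fun D => 2 ∉ D) with hO
  have hself : ∀ (K : Finset ℕ) x, x ∈ K → x ∈ skComp l K x := fun K x hx =>
    Finset.mem_filter.2 ⟨hx, Relation.ReflTransGen.refl⟩
  have h1J : 1 ∉ J := fun h => by have := hJ 1 h; omega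
  have h1C : 1 ∈ C := hself _ _ (by simp)
  have hCO : C ∉ O := by
    intro h
    obtain ⟨x, hx, hxC⟩ := Finset.mem_image.1 (Finset.mem_filter.1 h).1
    rw [← hxC] at h1C
    exact h1J (Finset.mem_filter.1 h1C).1
  -- components not containing 2
  have hnot : ∀ x ∈ J, 2 ∉ skComp l J x → skComp l (insert 1 J) x = skComp l J x := by
    intro x hx h2
    rw [skComp_insert hl hJ hx, Finset.erase_eq_of_notMem]
    intro h1
    obtain ⟨h3, h4⟩ := (skReach_back hl hJ hx (Finset.mem_filter.1 h1).2).2 rfl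
    exact h2 (Finset.mem_filter.2 ⟨h3, h4⟩)
  have hin : ∀ x ∈ J, 2 ∈ skComp l J x → skComp l (insert 1 J) x = C := by
    intro x hx h2
    obtain ⟨h3, h4⟩ := Finset.mem_filter.1 h2
    exact skComp_eq ((skReach_mono h4).trans (skReach_symm (sk_reach12 hl h3)))
  have hK : (insert 1 J).image (skComp l (insert 1 J)) = insert C O := by
    rw [Finset.image_insert]
    ext D
    simp only [Finset.mem_insert, Finset.mem_image, hO, Finset.mem_filter]
    constructor
    · rintro (h | ⟨x, hx, rfl⟩)
      · exact Or.inl h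
      · by_cases h2 : 2 ∈ skComp l J x
        · exact Or.inl (hin x hx h2)
        · rw [hnot x hx h2]
          exact Or.inr ⟨⟨x, hx, rfl⟩, h2⟩
    · rintro (h | ⟨⟨x, hx, rfl⟩, h2⟩)
      · exact Or.inl h
      · exact Or.inr ⟨x, hx, hnot x hx h2⟩
  rw [sk_degD, sk_degD, hK, Finset.sum_insert hCO]
  by_cases h2 : 2 ∈ J
  · have hC' : C.erase 1 = skComp l J 2 := by
      rw [skComp_insert hl hJ h2, hC, skComp_eq (sk_reach12 hl h2)]
    have hJc : J.image (skComp l J) = insert (C.erase 1) O := by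
      ext D
      simp only [Finset.mem_insert, Finset.mem_image, hO, Finset.mem_filter]
      constructor
      · rintro ⟨x, hx, rfl⟩
        by_cases h : 2 ∈ skComp l J x
        · left
          rw [hC']
          exact skComp_eq (Finset.mem_filter.1 h).2
        · exact Or.inr ⟨⟨x, hx, rfl⟩, h⟩
      · rintro (h | ⟨h, _⟩)
        · exact ⟨2, h2, by rw [h, hC']⟩
        · exact h
    have hn : C.erase 1 ∉ O := by
      intro h
      apply (Finset.mem_filter.1 h).2
      rw [hC']
      exact hself _ _ h2
    rw [hJc, Finset.sum_insert hn]
    ring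
  · have hOJ : J.image (skComp l J) = O := by
      rw [hO, Finset.filter_true_of_mem]
      intro D hD h
      obtain ⟨x, hx, rfl⟩ := Finset.mem_image.1 hD
      exact h2 (Finset.mem_filter.1 h).1
    have hCe : C.erase 1 = ∅ := by
      rw [Finset.eq_empty_iff_forall_notMem]
      intro y hy
      obtain ⟨hy1, hyC⟩ := Finset.mem_erase.1 hy
      obtain ⟨hyK, hyr⟩ := Finset.mem_filter.1 hyC
      have hyJ : y ∈ J := by
        rcases Finset.mem_insert.1 hyK with h | h
        · exact absurd h hy1
        · exact h
      exact h2 ((skReach_back hl hJ hyJ (skReach_symm hyr)).2 rfl).1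
    rw [hCe, hOJ]
    simp [skd]
    ring

theorem sk_diff {l : ℕ} (hl : 4 ≤ l) {J : Finset ℕ} (hJ : J ⊆ Finset.Icc 2 l) :
    (degD l (insert 1 J) : ℤ) - degD l J
      = (∑ y ∈ Finset.Icc 1 l, if skP l y ⊆ J then (1 : ℤ) else 0)
        + (if Finset.Icc 2 l ⊆ J then ((l : ℤ) - 2) else 0) := by
  have hJ' : ∀ x ∈ J, 2 ≤ x := fun x hx => (Finset.mem_Icc.1 (hJ hx)).1
  have h := sk_degD_insert hl hJ'
  set C := skComp l (insert 1 J) 1 with hC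
  have hCf : C = (Finset.Icc 1 l).filter (fun y => skP l y ⊆ J) := by
    ext y
    rw [Finset.mem_filter]
    constructor
    · intro hy
      have hy1 : y ∈ Finset.Icc 1 l := by
        rcases Finset.mem_insert.1 (Finset.mem_filter.1 hy).1 with h | h
        · simp [h]; omega
        · have := Finset.mem_Icc.1 (hJ h)
          simp; omega
      exact ⟨hy1, (skReach_one hl hJ hy1).1 hy⟩
    · rintro ⟨h1, h2⟩
      exact (skReach_one hl hJ h1).2 h2
  have hcard : (∑ y ∈ Finset.Icc 1 l, if skP l y ⊆ J then (1 : ℤ) else 0) = C.card := by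
    rw [hCf, Finset.sum_boole]
  have h1C : 1 ∈ C := Finset.mem_filter.2 ⟨by simp, Relation.ReflTransGen.refl⟩
  have hce := Finset.card_erase_add_one h1C
  have hiff : (l - 1 ∈ C ∧ l ∈ C) ↔ Finset.Icc 2 l ⊆ J := by
    rw [hC, skReach_one hl hJ (by simp; omega), skReach_one hl hJ (by simp; omega)]
    have e1 : skP l (l - 1) = Finset.Icc 2 (l - 1) := by
      unfold skP; rw [if_neg (by omega)]
    have e2 : skP l l = (Finset.Icc 2 l).erase (l - 1) := by
      unfold skP; rw [if_pos rfl]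
    rw [e1, e2]
    constructor
    · rintro ⟨h1, h2⟩ x hx
      have := Finset.mem_Icc.1 hx
      by_cases hxl : x = l - 1
      · exact h1 (by simp; omega)
      · exact h2 (by simp; omega)
    · intro h
      refine ⟨fun x hx => h ?_, fun x hx => h (Finset.mem_of_mem_erase hx)⟩
      simp at hx ⊢; omega
  have hiff' : (l - 1 ∈ C.erase 1 ∧ l ∈ C.erase 1) ↔ Finset.Icc 2 l ⊆ J := by
    rw [← hiff]
    simp only [Finset.mem_erase]
    constructor
    · tauto
    · rintro ⟨h1, h2⟩
      exact ⟨⟨by omega, h1⟩, ⟨by omega, h2⟩⟩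
  rw [hcard]
  simp only [skd, hiff, hiff'] at h
  split_ifs at h ⊢ with hf
  · have hCl : C.card = l := by
      rw [hCf, Finset.filter_true_of_mem]
      · simp
      · intro y hy
        refine subset_trans ?_ hf
        unfold skP
        have := Finset.mem_Icc.1 hy
        split_ifs
        · exact Finset.erase_subset _ _
        · exact Finset.Icc_subset_Icc le_rfl this.2
    have hE : (C.erase 1).card = l - 1 := by omega
    rw [hCl, hE] at h
    rw [hCl]
    obtain ⟨m, rfl⟩ : ∃ m, l = m + 2 := ⟨l - 2, by omega⟩
    simp only [show m + 2 - 1 = m + 1 from rfl, Nat.add_sub_cancel] at h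
    zify at h
    push_cast
    linarith
  · rw [← hce, Nat.choose_succ_succ' ((C.erase 1).card + 1) 1] at h
    simp at h
    rw [← hce]
    zify at h
    push_cast
    linarith

theorem sk_cancel {S P : Finset ℕ} {z : ℕ} (hz : z ∈ S) (hP : z ∉ P) :
    ∑ J ∈ S.powerset, (-1 : ℤ) ^ J.card * (if P ⊆ J then (1 : ℤ) else 0) = 0 := by
  rw [← Finset.insert_erase hz, Finset.sum_powerset_insert (Finset.notMem_erase z S),
    ← Finset.sum_add_distrib]
  refine Finset.sum_eq_zero fun J hJ => ?_
  have hzJ : z ∉ J := fun h => Finset.notMem_erase z S (Finset.mem_powerset.1 hJ h)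
  rw [Finset.card_insert_of_notMem hzJ]
  simp only [Finset.subset_insert_iff_of_notMem hP]
  ring

theorem sk_sum (l : ℕ) (hl : 4 ≤ l) :
    ∑ J ∈ (Finset.Icc 1 l).powerset, (-1 : ℤ) ^ J.card * (degD l J : ℤ)
      = (-1) ^ l * ((l : ℤ) - 2) := by
  have hI : Finset.Icc 1 l = insert 1 (Finset.Icc 2 l) := by
    ext x; simp; omega
  have h1 : (1 : ℕ) ∉ Finset.Icc 2 l := by simp
  rw [hI, Finset.sum_powerset_insert h1, ← Finset.sum_add_distrib]
  have hstep : ∀ J ∈ (Finset.Icc 2 l).powerset,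
      (-1 : ℤ) ^ J.card * (degD l J : ℤ)
        + (-1 : ℤ) ^ (insert 1 J).card * (degD l (insert 1 J) : ℤ)
      = -(∑ y ∈ Finset.Icc 1 l, (-1 : ℤ) ^ J.card * (if skP l y ⊆ J then (1 : ℤ) else 0))
        - (if J = Finset.Icc 2 l then (-1 : ℤ) ^ J.card * ((l : ℤ) - 2) else 0) := by
    intro J hJ
    have hJ := Finset.mem_powerset.1 hJ
    have h1J : 1 ∉ J := fun h => h1 (hJ h)
    have hd := sk_diff hl hJ
    have hEq : (J = Finset.Icc 2 l) ↔ Finset.Icc 2 l ⊆ J :=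
      ⟨fun h => h ▸ subset_rfl, fun h => subset_antisymm hJ h⟩
    simp only [hEq]
    rw [Finset.card_insert_of_notMem h1J, ← Finset.mul_sum, pow_succ]
    have hd' : (degD l (insert 1 J) : ℤ) = degD l J + _ := eq_add_of_sub_eq' hd
    rw [hd']
    split_ifs <;> ring
  rw [Finset.sum_congr rfl hstep, Finset.sum_sub_distrib, Finset.sum_neg_distrib,
    Finset.sum_comm, Finset.sum_eq_zero, Finset.sum_ite_eq', if_pos (by simp)]
  · obtain ⟨m, rfl⟩ : ∃ m, l = m + 1 := ⟨l - 1, by omega⟩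
    simp
    ring
  · intro y hy
    have hy := Finset.mem_Icc.1 hy
    by_cases hyl : y = l
    · refine sk_cancel (z := l - 1) (by simp; omega) ?_
      simp [skP, hyl]
    · refine sk_cancel (z := l) (by simp; omega) ?_
      simp only [skP, if_neg hyl, Finset.mem_Icc]
      omega

/-- For every integer `l ≥ 4`, the derivative at `t = 1` of the skew-growth function of
type `D_l` satisfies `N'_{D_l}(1) = Σ_{J ⊆ {1,…,l}} (-1)^{#J} · deg_D(J) = (-1)^l · (l - 2)`. -/
theorem skew_growth_deriv_one_typeD (l : ℕ) (hl : 4 ≤ l) :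
    Polynomial.eval (1 : ℤ) (Polynomial.derivative
        (∑ J ∈ (Finset.Icc 1 l).powerset,
          (-1 : Polynomial ℤ) ^ J.card * Polynomial.X ^ degD l J))
      = ∑ J ∈ (Finset.Icc 1 l).powerset, (-1 : ℤ) ^ J.card * (degD l J : ℤ) ∧
    ∑ J ∈ (Finset.Icc 1 l).powerset, (-1 : ℤ) ^ J.card * (degD l J : ℤ)
      = (-1) ^ l * ((l : ℤ) - 2) := by
  refine ⟨?_, sk_sum l hl⟩
  rw [Polynomial.derivative_sum, Polynomial.eval_finsetSum]
  refine Finset.sum_congr rfl fun J _ => ?_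
  have h : ((-1 : Polynomial ℤ) ^ J.card) = Polynomial.C ((-1 : ℤ) ^ J.card) := by simp
  rw [h, Polynomial.derivative_C_mul, Polynomial.derivative_X_pow]
  simp
end

section
/- For every integer l ≥ 4, the skew-growth polynomial N_{D_l}(t) = Σ_{J ⊆ {1,...,l}} (-1)^{#J} t^{deg_D(J)} ∈ ℤ[t] has t = 1 as a root of multiplicity exactly one (a simple root). -/
open scoped Classical

/-- The skew-growth polynomial of type `D_l`. -/
noncomputable def ND (l : ℕ) : Polynomial ℤ :=
  ∑ J ∈ (Finset.Icc 1 l).powerset, (-1 : Polynomial ℤ) ^ J.card * Polynomial.X ^ degD l J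

/-- The symmetrized adjacency restricted to `J`. -/
def stepIn (r : ℕ → ℕ → Prop) (J : Finset ℕ) (a b : ℕ) : Prop :=
  a ∈ J ∧ b ∈ J ∧ (r a b ∨ r b a)

/-- `C` is a nonempty connected vertex set. -/
def ConnSet (r : ℕ → ℕ → Prop) (C : Finset ℕ) : Prop :=
  ∃ x ∈ C, ∀ y ∈ C, Relation.ReflTransGen (stepIn r C) x y

/-- every vertex of `I` outside `C` is adjacent to `C`. -/
def DomSet (r : ℕ → ℕ → Prop) (I C : Finset ℕ) : Prop :=
  ∀ v ∈ I, v ∉ C → ∃ a ∈ C, r a v ∨ r v a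

lemma mem_componentsOf (r : ℕ → ℕ → Prop) (J C : Finset ℕ) :
    C ∈ componentsOf r J ↔
      C ⊆ J ∧ ConnSet r C ∧ ∀ a ∈ C, ∀ b ∈ J, (r a b ∨ r b a) → b ∈ C := by
  unfold componentsOf
  rw [Finset.mem_image]
  change (∃ x ∈ J, J.filter (fun y => Relation.ReflTransGen (stepIn r J) x y) = C) ↔ _
  constructor
  · rintro ⟨x, hx, hC⟩
    have hmem : ∀ y, y ∈ C ↔ y ∈ J ∧ Relation.ReflTransGen (stepIn r J) x y := by
      intro y
      rw [← hC, Finset.mem_filter]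
    refine ⟨fun y hy => ((hmem y).1 hy).1, ⟨x, (hmem x).2 ⟨hx, .refl⟩, ?_⟩, ?_⟩
    · intro y hy
      have h := ((hmem y).1 hy).2
      clear hy
      induction h with
      | refl => exact .refl
      | tail h1 h2 ih =>
        exact ih.tail ⟨(hmem _).2 ⟨h2.1, h1⟩, (hmem _).2 ⟨h2.2.1, h1.tail h2⟩, h2.2.2⟩
    · intro a ha b hb hab
      have h := (hmem a).1 ha
      exact (hmem b).2 ⟨hb, h.2.tail ⟨h.1, hb, hab⟩⟩
  · rintro ⟨hCJ, ⟨x, hx, hconn⟩, hcl⟩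
    refine ⟨x, hCJ hx, ?_⟩
    ext y
    rw [Finset.mem_filter]
    constructor
    · rintro ⟨-, h⟩
      induction h with
      | refl => exact hx
      | tail h1 h2 ih => exact hcl _ ih _ h2.2.1 h2.2.2
    · intro hy
      exact ⟨hCJ hy, Relation.ReflTransGen.mono (fun a b h => ⟨hCJ h.1, hCJ h.2.1, h.2.2⟩) _ _ (hconn y hy)⟩

lemma sum_fixed_component (r : ℕ → ℕ → Prop) (I C : Finset ℕ) (hC : C ⊆ I) :
    ∑ J ∈ I.powerset, (if C ∈ componentsOf r J then (-1 : ℤ) ^ J.card else 0)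
      = if ConnSet r C ∧ DomSet r I C then (-1 : ℤ) ^ C.card else 0 := by
  by_cases hconn : ConnSet r C
  swap
  · rw [if_neg (fun h => hconn h.1)]
    refine Finset.sum_eq_zero fun J _ => ?_
    rw [if_neg]
    rw [mem_componentsOf]
    exact fun h => hconn h.2.1
  by_cases hdom : DomSet r I C
  · rw [if_pos ⟨hconn, hdom⟩, Finset.sum_eq_single C]
    · rw [if_pos]
      rw [mem_componentsOf]
      exact ⟨subset_rfl, hconn, fun _ _ b hb _ => hb⟩
    · intro J hJ hne
      rw [if_neg]
      rw [mem_componentsOf]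
      rintro ⟨h1, -, h3⟩
      apply hne
      refine (Finset.Subset.antisymm h1 ?_).symm
      intro v hv
      by_contra hvC
      obtain ⟨a, ha, hav⟩ := hdom v (Finset.mem_powerset.1 hJ hv) hvC
      exact hvC (h3 a ha v hv hav)
    · intro h
      exact absurd (Finset.mem_powerset.2 hC) h
  · rw [if_neg (fun h => hdom h.2)]
    unfold DomSet at hdom
    push Not at hdom
    obtain ⟨v, hvI, hvC, hv⟩ := hdom
    rw [← Finset.insert_erase hvI, Finset.sum_powerset_insert (Finset.notMem_erase v I),
      ← Finset.sum_add_distrib]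
    refine Finset.sum_eq_zero fun J hJ => ?_
    have hvJ : v ∉ J := fun h => Finset.notMem_erase v I (Finset.mem_powerset.1 hJ h)
    have hiff : C ∈ componentsOf r (insert v J) ↔ C ∈ componentsOf r J := by
      rw [mem_componentsOf, mem_componentsOf, Finset.subset_insert_iff_of_notMem hvC]
      refine and_congr Iff.rfl (and_congr Iff.rfl ?_)
      constructor
      · exact fun h a ha b hb => h a ha b (Finset.mem_insert_of_mem hb)
      · intro h a ha b hb hab
        rcases Finset.mem_insert.1 hb with rfl | hb
        · have := hv a ha
          tauto
        · exact h a ha b hb hab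
    simp only [hiff]
    split_ifs
    · rw [Finset.card_insert_of_notMem hvJ]
      ring
    · simp

lemma sum_components (r : ℕ → ℕ → Prop) (I : Finset ℕ) (d : Finset ℕ → ℕ) :
    ∑ J ∈ I.powerset, (-1 : ℤ) ^ J.card * ((∑ C ∈ componentsOf r J, d C : ℕ) : ℤ)
      = ∑ C ∈ I.powerset.filter (fun C => ConnSet r C ∧ DomSet r I C),
          (-1 : ℤ) ^ C.card * (d C : ℤ) := by
  have h1 : ∀ J ∈ I.powerset,
      (-1 : ℤ) ^ J.card * ((∑ C ∈ componentsOf r J, d C : ℕ) : ℤ)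
        = ∑ C ∈ I.powerset,
          (if C ∈ componentsOf r J then (-1 : ℤ) ^ J.card else 0) * (d C : ℤ) := by
    intro J hJ
    push_cast
    rw [Finset.mul_sum]
    simp only [ite_mul, zero_mul]
    rw [← Finset.sum_filter]
    refine Finset.sum_congr ?_ fun _ _ => rfl
    ext C
    rw [Finset.mem_filter, Finset.mem_powerset]
    constructor
    · intro h
      exact ⟨((mem_componentsOf r J C).1 h).1.trans (Finset.mem_powerset.1 hJ), h⟩
    · exact fun h => h.2
  rw [Finset.sum_congr rfl h1, Finset.sum_comm, Finset.sum_filter]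
  refine Finset.sum_congr rfl fun C hC => ?_
  rw [← Finset.sum_mul, sum_fixed_component r I C (Finset.mem_powerset.1 hC)]
  split_ifs <;> simp

lemma core_subset (n : ℕ) (C : Finset ℕ) (hconn : ConnSet (adjD (n + 4)) C)
    (hdom : DomSet (adjD (n + 4)) (Finset.Icc 1 (n + 4)) C) :
    Finset.Icc 2 (n + 2) ⊆ C := by
  intro k hk
  rw [Finset.mem_Icc] at hk
  by_contra hkC
  have hlow : ∃ a ∈ C, a < k := by
    by_cases h1 : 1 ∈ C
    · exact ⟨1, h1, by omega⟩
    · obtain ⟨a, ha, hadj⟩ := hdom 1 (by simp) h1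
      have hak : a ≠ k := fun h => hkC (h ▸ ha)
      refine ⟨a, ha, ?_⟩
      unfold adjD at hadj
      omega
  have hhigh : ∃ a ∈ C, k < a := by
    by_cases h1 : n + 3 ∈ C
    · exact ⟨n + 3, h1, by omega⟩
    · obtain ⟨a, ha, hadj⟩ := hdom (n + 3) (by simp) h1
      have hak : a ≠ k := fun h => hkC (h ▸ ha)
      refine ⟨a, ha, ?_⟩
      unfold adjD at hadj
      omega
  have hpres : ∀ x y, Relation.ReflTransGen (stepIn (adjD (n + 4)) C) x y →
      (x < k ↔ y < k) := by
    intro x y h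
    induction h with
    | refl => exact Iff.rfl
    | @tail b c h1 h2 ih =>
      rw [ih]
      have hb : b ≠ k := fun h => hkC (h ▸ h2.1)
      have hc : c ≠ k := fun h => hkC (h ▸ h2.2.1)
      have h3 := h2.2.2
      unfold adjD at h3
      omega
  obtain ⟨x, -, hx⟩ := hconn
  obtain ⟨a, ha, hak⟩ := hlow
  obtain ⟨b, hb, hbk⟩ := hhigh
  have e1 := hpres x a (hx a ha)
  have e2 := hpres x b (hx b hb)
  omega

lemma good_of_core (n : ℕ) (C : Finset ℕ) (hCI : C ⊆ Finset.Icc 1 (n + 4))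
    (hM : Finset.Icc 2 (n + 2) ⊆ C) :
    ConnSet (adjD (n + 4)) C ∧ DomSet (adjD (n + 4)) (Finset.Icc 1 (n + 4)) C := by
  have hmem : ∀ k, 2 ≤ k → k ≤ n + 2 → k ∈ C := fun k h1 h2 =>
    hM (Finset.mem_Icc.2 ⟨h1, h2⟩)
  have hmid : ∀ k, k ≤ n →
      Relation.ReflTransGen (stepIn (adjD (n + 4)) C) 2 (k + 2) := by
    intro k
    induction k with
    | zero => exact fun _ => .refl
    | succ k ih =>
      intro hk
      refine (ih (by omega)).tail ⟨hmem _ (by omega) (by omega), hmem _ (by omega) (by omega), ?_⟩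
      unfold adjD
      omega
  constructor
  · refine ⟨2, hmem 2 le_rfl (by omega), ?_⟩
    intro y hy
    have hyI := Finset.mem_Icc.1 (hCI hy)
    by_cases h1 : y = 1
    · subst h1
      refine .single ⟨hmem 2 le_rfl (by omega), hy, ?_⟩
      unfold adjD
      omega
    by_cases h2 : y ≤ n + 2
    · have := hmid (y - 2) (by omega)
      rwa [Nat.sub_add_cancel (by omega)] at this
    · refine (hmid n le_rfl).tail ⟨hmem _ (by omega) (by omega), hy, ?_⟩
      unfold adjD
      omega
  · intro v hv hvC
    have hvI := Finset.mem_Icc.1 hv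
    by_cases h1 : v = 1
    · refine ⟨2, hmem 2 le_rfl (by omega), ?_⟩
      unfold adjD
      omega
    · have h2 : ¬ v ≤ n + 2 := fun h => hvC (hmem v (by omega) h)
      refine ⟨n + 2, hmem _ (by omega) (by omega), ?_⟩
      unfold adjD
      omega

lemma good_filter (n : ℕ) :
    (Finset.Icc 1 (n + 4)).powerset.filter (fun C => ConnSet (adjD (n + 4)) C ∧
      DomSet (adjD (n + 4)) (Finset.Icc 1 (n + 4)) C)
    = ({1, n + 3, n + 4} : Finset ℕ).powerset.image (fun S => Finset.Icc 2 (n + 2) ∪ S) := by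
  ext C
  rw [Finset.mem_filter, Finset.mem_image, Finset.mem_powerset]
  constructor
  · rintro ⟨hCI, h1, h2⟩
    have hM := core_subset n C h1 h2
    refine ⟨C \ Finset.Icc 2 (n + 2), ?_, Finset.union_sdiff_of_subset hM⟩
    rw [Finset.mem_powerset]
    intro x hx
    rw [Finset.mem_sdiff, Finset.mem_Icc] at hx
    have := Finset.mem_Icc.1 (hCI hx.1)
    simp only [Finset.mem_insert, Finset.mem_singleton]
    omega
  · rintro ⟨S, hS, rfl⟩
    rw [Finset.mem_powerset] at hS
    have hsub : Finset.Icc 2 (n + 2) ∪ S ⊆ Finset.Icc 1 (n + 4) := by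
      intro x hx
      rw [Finset.mem_union, Finset.mem_Icc] at hx
      rw [Finset.mem_Icc]
      rcases hx with hx | hx
      · omega
      · have := hS hx
        simp only [Finset.mem_insert, Finset.mem_singleton] at this
        omega
    exact ⟨hsub, good_of_core n _ hsub Finset.subset_union_left⟩

lemma disj_core (n : ℕ) (S : Finset ℕ) (hS : S ⊆ {1, n + 3, n + 4}) :
    Disjoint (Finset.Icc 2 (n + 2)) S := by
  rw [Finset.disjoint_left]
  intro x hx hxS
  have := hS hxS
  simp only [Finset.mem_insert, Finset.mem_singleton] at this
  rw [Finset.mem_Icc] at hx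
  omega

lemma deriv_sum_D (n : ℕ) :
    ∑ J ∈ (Finset.Icc 1 (n + 4)).powerset, (-1 : ℤ) ^ J.card * (degD (n + 4) J : ℤ)
      = (-1) ^ n * (n + 2) := by
  unfold degD
  rw [sum_components (adjD (n + 4)) (Finset.Icc 1 (n + 4)) (fun C =>
    if n + 4 - 1 ∈ C ∧ n + 4 ∈ C then C.card * (C.card - 1) else (C.card + 1).choose 2),
    good_filter, Finset.sum_image]
  · have hterm : ∀ S ∈ ({1, n + 3, n + 4} : Finset ℕ).powerset,
        (-1 : ℤ) ^ (Finset.Icc 2 (n + 2) ∪ S).card *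
          ((if n + 4 - 1 ∈ Finset.Icc 2 (n + 2) ∪ S ∧ n + 4 ∈ Finset.Icc 2 (n + 2) ∪ S then
            (Finset.Icc 2 (n + 2) ∪ S).card * ((Finset.Icc 2 (n + 2) ∪ S).card - 1)
            else ((Finset.Icc 2 (n + 2) ∪ S).card + 1).choose 2 : ℕ) : ℤ)
        = (-1 : ℤ) ^ (n + 1 + S.card) *
          ((if n + 3 ∈ S ∧ n + 4 ∈ S then (n + 1 + S.card) * (n + S.card)
            else (n + 1 + S.card + 1).choose 2 : ℕ) : ℤ) := by
      intro S hS
      have hc : (Finset.Icc 2 (n + 2) ∪ S).card = n + 1 + S.card := by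
        rw [Finset.card_union_of_disjoint (disj_core n S (Finset.mem_powerset.1 hS)),
          Nat.card_Icc]
        omega
      have m1 : n + 4 - 1 ∈ Finset.Icc 2 (n + 2) ∪ S ↔ n + 3 ∈ S := by
        rw [Finset.mem_union, Finset.mem_Icc]
        constructor
        · rintro (h | h)
          · omega
          · exact h
        · exact Or.inr
      have m2 : n + 4 ∈ Finset.Icc 2 (n + 2) ∪ S ↔ n + 4 ∈ S := by
        rw [Finset.mem_union, Finset.mem_Icc]
        constructor
        · rintro (h | h)
          · omega
          · exact h
        · exact Or.inr
      have hs : n + 1 + S.card - 1 = n + S.card := by omega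
      simp only [hc, m1, m2, hs]
    rw [Finset.sum_congr rfl hterm]
    rw [Finset.sum_powerset_insert (by simp), Finset.sum_powerset_insert (by simp),
      Finset.sum_powerset_insert (by simp)]
    have hp : ({n + 4} : Finset ℕ).powerset = {∅, {n + 4}} := by
      ext; simp [Finset.subset_singleton_iff]
    have hch : ∀ k : ℕ, (((k + 1).choose 2 : ℕ) : ℤ) * 2 = (k + 1) * k := by
      intro k
      have := Nat.choose_two_right (k + 1)
      have h2 := Nat.div_mul_cancel (Nat.even_mul_pred_self (k + 1)).two_dvd
      rw [← this] at h2
      simp only [Nat.add_sub_cancel] at h2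
      exact_mod_cast h2
    simp [hp]
    have a1 := hch (n + 1)
    have a2 := hch (n + 1 + 1)
    have a3 := hch (n + 1 + 2)
    push_cast at a1 a2 a3
    refine mul_right_cancel₀ (two_ne_zero (α := ℤ)) ?_
    simp only [pow_succ, pow_add]
    linear_combination (-(-1 : ℤ) ^ n) * a1 + 3 * (-1 : ℤ) ^ n * a2 - 2 * (-1 : ℤ) ^ n * a3
  · intro S hS T hT h
    have hS' := disj_core n S (Finset.mem_powerset.1 hS)
    have hT' := disj_core n T (Finset.mem_powerset.1 hT)
    simp only at h
    rw [← Finset.union_sdiff_cancel_left hS', h, Finset.union_sdiff_cancel_left hT']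

/-- For every integer `l ≥ 4`, the skew-growth polynomial `N_{D_l}(t)` has `t = 1`
as a root of multiplicity exactly one. -/
theorem skew_growth_simple_root_typeD (l : ℕ) (hl : 4 ≤ l) :
    Polynomial.rootMultiplicity 1 (ND l) = 1 := by
  obtain ⟨n, rfl⟩ : ∃ n, l = n + 4 := ⟨l - 4, by omega⟩
  have h0 : (ND (n + 4)).IsRoot 1 := by
    unfold ND
    rw [Polynomial.IsRoot.def, Polynomial.eval_finsetSum]
    simp only [Polynomial.eval_mul, Polynomial.eval_pow, Polynomial.eval_neg,
      Polynomial.eval_one, Polynomial.eval_X, one_pow, mul_one]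
    exact Finset.sum_powerset_neg_one_pow_card_of_nonempty ⟨1, by simp⟩
  have h1 : (Polynomial.derivative (ND (n + 4))).eval 1 = (-1) ^ n * (n + 2) := by
    rw [← deriv_sum_D]
    unfold ND
    rw [Polynomial.derivative_sum, Polynomial.eval_finsetSum]
    refine Finset.sum_congr rfl fun J _ => ?_
    have : ((-1 : Polynomial ℤ) ^ J.card) = Polynomial.C ((-1 : ℤ) ^ J.card) := by simp
    rw [this, Polynomial.derivative_C_mul, Polynomial.derivative_X_pow]
    simp
  have hne : (Polynomial.derivative (ND (n + 4))).eval 1 ≠ 0 := by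
    rw [h1]
    have : (n : ℤ) + 2 ≠ 0 := by omega
    exact mul_ne_zero (pow_ne_zero _ (by norm_num)) this
  have hp : ND (n + 4) ≠ 0 := by
    intro h
    rw [h] at hne
    simp at hne
  have hpos := (Polynomial.rootMultiplicity_pos hp).2 h0
  have hle : ¬ 1 < Polynomial.rootMultiplicity 1 (ND (n + 4)) := by
    rw [Polynomial.one_lt_rootMultiplicity_iff_isRoot hp]
    exact fun h => hne h.2
  omega
end

section
/- Let j and k be positive integers with k ≤ j. Then Σ_{(τ_1,...,τ_k)} Σ_{i=1}^{k} binomial(τ_i + 1, 2) = k · binomial(j + 1, k + 1), where the outer sum ranges over all k-tuples (τ_1,...,τ_k) of positive integers with τ_1 + ... + τ_k = j (i.e., over all compositions of j into k positive parts). -/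
open scoped Classical

/-- The set of compositions. -/
noncomputable def posComp (k j : ℕ) : Finset (Fin k → ℕ) :=
  (Finset.Nat.antidiagonalTuple k j).filter (fun τ => ∀ i, 1 ≤ τ i)

theorem mem_posComp {k j : ℕ} {τ : Fin k → ℕ} :
    τ ∈ posComp k j ↔ ∑ i, τ i = j ∧ ∀ i, 1 ≤ τ i := by
  simp [posComp, Finset.Nat.mem_antidiagonalTuple]

theorem sum_posComp_succ (k j : ℕ) (F : (Fin (k + 1) → ℕ) → ℤ) :
    ∑ τ ∈ posComp (k + 1) j, F τ =
      ∑ p ∈ Finset.HasAntidiagonal.antidiagonal j,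
        if 1 ≤ p.1 then ∑ τ ∈ posComp k p.2, F (Fin.cons p.1 τ) else 0 := by
  rw [← Finset.sum_filter, Finset.sum_sigma']
  refine Finset.sum_bij' (fun τ _ => ⟨(τ 0, ∑ i, Fin.tail τ i), Fin.tail τ⟩)
    (fun x _ => Fin.cons x.1.1 x.2) ?_ ?_ ?_ ?_ ?_
  · intro τ h
    rw [mem_posComp, Fin.sum_univ_succ] at h
    simp only [Finset.mem_sigma, Finset.mem_filter, Finset.HasAntidiagonal.mem_antidiagonal, mem_posComp, true_and]
    exact ⟨⟨h.1, h.2 0⟩, fun i => h.2 i.succ⟩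
  · rintro ⟨⟨a, b⟩, τ⟩ h
    simp only [Finset.mem_sigma, Finset.mem_filter, Finset.HasAntidiagonal.mem_antidiagonal, mem_posComp] at h
    rw [mem_posComp, Fin.sum_univ_succ, Fin.forall_fin_succ]
    simp only [Fin.cons_zero, Fin.cons_succ]
    exact ⟨by rw [h.2.1]; exact h.1.1, h.1.2, h.2.2⟩
  · intro τ h
    simp
  · rintro ⟨⟨a, b⟩, τ⟩ h
    simp only [Finset.mem_sigma, Finset.mem_filter, Finset.HasAntidiagonal.mem_antidiagonal, mem_posComp] at h
    obtain ⟨_, rfl, _⟩ := h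
    simp
  · intro τ h
    simp

/-- generating function of all-ones. -/
noncomputable def serF : PowerSeries ℤ := PowerSeries.mk fun a => if 1 ≤ a then 1 else 0

/-- generating function of the weights. -/
noncomputable def serG : PowerSeries ℤ := PowerSeries.mk fun a => ((a + 1).choose 2 : ℤ)

theorem serF_eq : serF = PowerSeries.X * (PowerSeries.invOneSubPow ℤ 1).val := by
  ext n
  cases n with
  | zero => simp [serF]
  | succ n => simp [serF, PowerSeries.coeff_succ_X_mul, PowerSeries.invOneSubPow_val_succ_eq_mk_add_choose]

theorem serG_eq : serG = PowerSeries.X * (PowerSeries.invOneSubPow ℤ 3).val := by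
  ext n
  cases n with
  | zero => simp [serG]
  | succ n =>
    rw [PowerSeries.coeff_succ_X_mul, PowerSeries.invOneSubPow_val_succ_eq_mk_add_choose]
    simp [serG, add_comm, add_left_comm]

theorem serN_eq (k : ℕ) :
    (PowerSeries.mk fun j => ∑ τ ∈ posComp k j, (1 : ℤ)) = serF ^ k := by
  induction k with
  | zero =>
    ext j
    cases j with
    | zero => simp [posComp]
    | succ j => simp [posComp, PowerSeries.coeff_one]
  | succ k ih =>
    rw [pow_succ', ← ih]
    ext j
    rw [PowerSeries.coeff_mul, PowerSeries.coeff_mk, sum_posComp_succ]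
    refine Finset.sum_congr rfl fun p _ => ?_
    simp [serF]

theorem serS_eq (k : ℕ) :
    (PowerSeries.mk fun j => ∑ τ ∈ posComp (k + 1) j, ∑ i, ((τ i + 1).choose 2 : ℤ)) =
      (k + 1 : ℕ) • (serG * serF ^ k) := by
  have key : ∀ k : ℕ,
      (PowerSeries.mk fun j => ∑ τ ∈ posComp (k + 1) j, ∑ i, ((τ i + 1).choose 2 : ℤ)) =
      serG * serF ^ k +
        serF * (PowerSeries.mk fun j => ∑ τ ∈ posComp k j, ∑ i, ((τ i + 1).choose 2 : ℤ)) := by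
    intro k
    rw [← serN_eq]
    ext j
    rw [map_add, PowerSeries.coeff_mul, PowerSeries.coeff_mul, PowerSeries.coeff_mk,
      sum_posComp_succ, ← Finset.sum_add_distrib]
    refine Finset.sum_congr rfl fun p _ => ?_
    rcases Nat.eq_zero_or_pos p.1 with h | h
    · simp [serF, serG, h]
    · have h' : 1 ≤ p.1 := h
      simp [serF, serG, h', Fin.sum_univ_succ, Finset.sum_add_distrib, mul_comm]
  induction k with
  | zero =>
    rw [key]
    have : (PowerSeries.mk fun j => ∑ τ ∈ posComp 0 j, ∑ i, ((τ i + 1).choose 2 : ℤ)) = 0 := by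
      ext j; simp
    rw [this]; simp
  | succ k ih =>
    rw [key, ih, nsmul_eq_mul, nsmul_eq_mul]
    push_cast
    ring

/-- For positive integers `j, k` with `k ≤ j`, summing `Σ_{i=1}^{k} binom(τ_i + 1, 2)`
over all compositions `(τ_1,…,τ_k)` of `j` into `k` positive parts gives
`k · binom(j + 1, k + 1)`. -/
theorem sum_over_compositions (j k : ℕ) (hk : 1 ≤ k) (hkj : k ≤ j) :
    ∑ τ ∈ (Finset.Nat.antidiagonalTuple k j).filter (fun τ => ∀ i, 1 ≤ τ i),
      ∑ i, (τ i + 1).choose 2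
      = k * (j + 1).choose (k + 1) := by

  obtain ⟨k, rfl⟩ : ∃ m, k = m + 1 := ⟨k - 1, by omega⟩
  obtain ⟨n, rfl⟩ : ∃ n, j = n + (k + 1) := ⟨j - (k + 1), by omega⟩
  have h := congrArg (PowerSeries.coeff (n + (k + 1))) (serS_eq k)
  have e : serG * serF ^ k =
      PowerSeries.X ^ (k + 1) * (PowerSeries.invOneSubPow ℤ (k + 2 + 1)).val := by
    have h1 : PowerSeries.invOneSubPow ℤ (k + 2 + 1) =
        PowerSeries.invOneSubPow ℤ 3 * PowerSeries.invOneSubPow ℤ 1 ^ k := by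
      simp_rw [PowerSeries.invOneSubPow_eq_inv_one_sub_pow, pow_one, ← pow_add]
      congr 1
      omega
    rw [serF_eq, serG_eq, h1, Units.val_mul, Units.val_pow_eq_pow_val]
    ring
  rw [e, PowerSeries.coeff_mk, map_nsmul, PowerSeries.coeff_X_pow_mul,
    PowerSeries.invOneSubPow_val_succ_eq_mk_add_choose, PowerSeries.coeff_mk, nsmul_eq_mul] at h
  have h2 : k + 2 + n = n + (k + 1) + 1 := by omega
  rw [h2] at h
  unfold posComp at h
  exact_mod_cast h
end

section
/- Let l, j, k be positive integers with j ≤ l and k ≤ min(j, l - j + 1). Then Σ_{J} deg_A(J) = k · binomial(j + 1, k + 1) · binomial(l - j + 1, k), where the sum ranges over all subsets J ⊆ {1,...,l} with #J = j whose decomposition into maximal blocks of consecutive integers has exactly k blocks. -/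
open scoped Classical

namespace DegAProof

/-- Weighted sum over subsets, computed recursively from the statistics
(size, co-size, number of blocks, trailing run, degree). -/
def G : ℕ → (ℕ → ℕ → ℕ → ℕ → ℕ → ℕ) → ℕ
  | 0, f => f 0 0 0 0 0
  | l + 1, f => G l (fun j m k t d => f j (m + 1) k 0 d
      + f (j + 1) m (k + if t = 0 then 1 else 0) (t + 1) (d + t + 1))

lemma G_add (l : ℕ) : ∀ f g : ℕ → ℕ → ℕ → ℕ → ℕ → ℕ,
    G l (fun j m k t d => f j m k t d + g j m k t d) = G l f + G l g := by
  induction l with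
  | zero => intro f g; rfl
  | succ l ih =>
    intro f g
    simp only [G]
    rw [← ih]
    congr 1
    funext j m k t d
    ring

lemma G_zero (l : ℕ) : G l (fun _ _ _ _ _ => 0) = 0 := by
  induction l with
  | zero => rfl
  | succ l ih => simpa only [G, add_zero] using ih

def NA (l j m k : ℕ) : ℕ :=
  G l (fun j' m' k' t _ => if j' = j ∧ m' = m ∧ k' = k ∧ t = 0 then 1 else 0)
def NB (l j m k : ℕ) : ℕ :=
  G l (fun j' m' k' t _ => if j' = j ∧ m' = m ∧ k' = k ∧ t ≠ 0 then 1 else 0)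
def T (l j m k : ℕ) : ℕ :=
  G l (fun j' m' k' t _ => if j' = j ∧ m' = m ∧ k' = k then t else 0)
def SA (l j m k : ℕ) : ℕ :=
  G l (fun j' m' k' t d => if j' = j ∧ m' = m ∧ k' = k ∧ t = 0 then d else 0)
def SB (l j m k : ℕ) : ℕ :=
  G l (fun j' m' k' t d => if j' = j ∧ m' = m ∧ k' = k ∧ t ≠ 0 then d else 0)

lemma NA_zero (l j k : ℕ) : NA (l+1) j 0 k = 0 := by
  unfold NA; rw [G]; refine Eq.trans (congrArg (G l) ?_) (G_zero l); funext j' m' k' t d; simp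
lemma NA_succ (l j m k : ℕ) : NA (l+1) j (m+1) k = NA l j m k + NB l j m k := by
  unfold NA NB; rw [G, ← G_add]; congr 1; funext j' m' k' t d
  grind
lemma NB_zero (l m k : ℕ) : NB (l+1) 0 m k = 0 := by
  unfold NB; rw [G]; refine Eq.trans (congrArg (G l) ?_) (G_zero l); funext j' m' k' t d; simp
lemma NB_succ (l j m k : ℕ) : NB (l+1) (j+1) m (k+1) = NB l j m (k+1) + NA l j m k := by
  unfold NA NB; rw [G, ← G_add]; congr 1; funext j' m' k' t d
  grind
lemma T_zero (l m k : ℕ) : T (l+1) 0 m k = 0 := by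
  unfold T; rw [G]; refine Eq.trans (congrArg (G l) ?_) (G_zero l); funext j' m' k' t d; simp
lemma T_succ (l j m k : ℕ) :
    T (l+1) (j+1) m (k+1) = T l j m (k+1) + NB l j m (k+1) + NA l j m k := by
  unfold T NA NB; rw [G, ← G_add, ← G_add]; congr 1; funext j' m' k' t d
  grind
lemma SA_zero (l j k : ℕ) : SA (l+1) j 0 k = 0 := by
  unfold SA; rw [G]; refine Eq.trans (congrArg (G l) ?_) (G_zero l); funext j' m' k' t d; simp
lemma SA_succ (l j m k : ℕ) : SA (l+1) j (m+1) k = SA l j m k + SB l j m k := by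
  unfold SA SB; rw [G, ← G_add]; congr 1; funext j' m' k' t d
  grind
lemma SB_zero (l m k : ℕ) : SB (l+1) 0 m k = 0 := by
  unfold SB; rw [G]; refine Eq.trans (congrArg (G l) ?_) (G_zero l); funext j' m' k' t d; simp
lemma SB_succ (l j m k : ℕ) :
    SB (l+1) (j+1) m (k+1) = SB l j m (k+1) + SA l j m k
      + (T l j m (k+1) + NB l j m (k+1) + NA l j m k) := by
  unfold T NA NB SA SB; rw [G, ← G_add, ← G_add, ← G_add, ← G_add]; congr 1
  funext j' m' k' t d
  grind

/-- nothing with a nonempty trailing run has zero blocks -/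
lemma G_k0 (l : ℕ) : ∀ f : ℕ → ℕ → ℕ → ℕ → ℕ → ℕ,
    (∀ j m k t d, (k ≠ 0 ∨ t = 0) → f j m k t d = 0) → G l f = 0 := by
  induction l with
  | zero => intro f hf; exact hf _ _ _ _ _ (Or.inr rfl)
  | succ l ih =>
    intro f hf
    rw [G]
    apply ih
    intro j m k t d h
    rw [hf _ _ _ _ _ (Or.inr rfl), hf _ _ _ _ _ (Or.inl _)]
    rcases h with h | h
    · omega
    · simp [h]

lemma NB_k0 (l j m : ℕ) : NB l j m 0 = 0 := by
  apply G_k0; intros; grind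
lemma T_k0 (l j m : ℕ) : T l j m 0 = 0 := by
  apply G_k0; intros; grind
lemma SB_k0 (l j m : ℕ) : SB l j m 0 = 0 := by
  apply G_k0; intros; grind

def cA : ℕ → ℕ → ℕ → ℕ
  | 0, _, 0 => 1
  | 0, _, _ + 1 => 0
  | _ + 1, _, 0 => 0
  | j + 1, m, k + 1 => j.choose k * m.choose (k + 1)
def cB : ℕ → ℕ → ℕ → ℕ
  | 0, _, _ => 0
  | _ + 1, _, 0 => 0
  | j + 1, m, k + 1 => j.choose k * m.choose k

lemma closed (l : ℕ) : ∀ j m k, j + m = l →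
    NA l j m k = cA j m k ∧ NB l j m k = cB j m k ∧
    (T l j m (k+1) = j.choose (k+1) * m.choose k) ∧
    SA l j m k = k * (j+1).choose (k+1) * m.choose k ∧
    SB l j m (k+1) = (k+1) * (j+1).choose (k+2) * m.choose k := by
  induction l with
  | zero =>
    intro j m k h
    obtain ⟨rfl, rfl⟩ : j = 0 ∧ m = 0 := by omega
    rcases k with _ | k <;> simp [NA, NB, T, SA, SB, G, cA, cB, Nat.choose]
  | succ l ih =>
    intro j m k h
    refine ⟨?_, ?_, ?_, ?_, ?_⟩
    · rcases m with _ | m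
      · obtain rfl : j = l + 1 := by omega
        rw [NA_zero]; rcases k with _ | k <;> simp [cA]
      · obtain ⟨h1, h2, -⟩ := ih j m k (by omega)
        rw [NA_succ, h1, h2]
        rcases j with _ | j <;> rcases k with _ | k <;> simp [cA, cB]
        rw [Nat.choose_succ_succ m k]; ring
    · rcases j with _ | j
      · rw [NB_zero]; simp [cB]
      rcases k with _ | k
      · rw [NB_k0]; simp [cB]
      obtain ⟨-, h2, -⟩ := ih j m (k+1) (by omega)
      obtain ⟨h1, -⟩ := ih j m k (by omega)
      rw [NB_succ, h1, h2]
      rcases j with _ | j <;> rcases k with _ | k <;> simp [cA, cB]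
      rw [Nat.choose_succ_succ j k]; ring
    · rcases j with _ | j
      · rw [T_zero]; simp
      obtain ⟨-, h2, -⟩ := ih j m (k+1) (by omega)
      obtain ⟨h1, -, h3, -⟩ := ih j m k (by omega)
      rw [T_succ, h1, h2, h3]
      rcases j with _ | j <;> rcases k with _ | k <;> simp [cA, cB]
      · exact Or.inl (Nat.choose_eq_zero_of_lt (by omega))
      · rw [Nat.choose_succ_succ (j+1) (k+1), Nat.choose_succ_succ j k]; ring
    · rcases m with _ | m
      · rw [SA_zero]; rcases k with _ | k <;> simp
      · obtain ⟨-, -, -, h4, -⟩ := ih j m k (by omega)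
        rw [SA_succ, h4]
        rcases k with _ | k
        · rw [SB_k0]; simp
        · obtain ⟨-, -, -, -, h5⟩ := ih j m k (by omega)
          rw [h5, Nat.choose_succ_succ m k]; ring
    · rcases j with _ | j
      · rw [SB_zero, Nat.choose_eq_zero_of_lt (by omega)]; simp
      obtain ⟨-, h2, -⟩ := ih j m (k+1) (by omega)
      obtain ⟨h1, -, h3, h4, h5⟩ := ih j m k (by omega)
      have e : NB l j m (k+1) + NA l j m k = j.choose k * m.choose k := by
        rw [h1, h2]
        rcases j with _ | j <;> rcases k with _ | k <;> simp [cA, cB]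
        rw [Nat.choose_succ_succ j k]; ring
      rw [SB_succ, add_assoc (T l j m (k+1)), e, h3, h4, h5,
        Nat.choose_succ_succ (j+1) (k+1), Nat.choose_succ_succ j k]; ring

lemma closed_total (j m k : ℕ) :
    G (j+m) (fun j' m' k' _ d => if j' = j ∧ m' = m ∧ k' = k then d else 0)
      = k * (j+1).choose (k+1) * (m+1).choose k := by
  have e : G (j+m) (fun j' m' k' _ d => if j' = j ∧ m' = m ∧ k' = k then d else 0)
      = SA (j+m) j m k + SB (j+m) j m k := by
    unfold SA SB; rw [← G_add]; congr 1; funext j' m' k' t d; grind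
  rw [e]
  obtain ⟨-, -, -, h4, -⟩ := closed (j+m) j m k rfl
  rw [h4]
  rcases k with _ | k
  · rw [SB_k0]; simp
  · obtain ⟨-, -, -, -, h5⟩ := closed (j+m) j m k rfl
    rw [h5, Nat.choose_succ_succ m k]; ring

/-- the block of `J` through `x` (empty when `x ∉ J`) -/
noncomputable def blk (J : Finset ℕ) (x : ℕ) : Finset ℕ :=
  J.filter fun y => ∀ z, min x y ≤ z → z ≤ max x y → z ∈ J

/-- right ends of blocks -/
noncomputable def ends (J : Finset ℕ) : Finset ℕ := J.filter fun x => x + 1 ∉ J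

lemma reach_up (J : Finset ℕ) (x n : ℕ) (h : ∀ z, x ≤ z → z ≤ x + n → z ∈ J) :
    Relation.ReflTransGen (fun a b => a ∈ J ∧ b ∈ J ∧ (adjA a b ∨ adjA b a)) x (x+n) := by
  induction n with
  | zero => exact Relation.ReflTransGen.refl
  | succ n ih =>
    refine (ih fun z h1 h2 => h z h1 (by omega)).tail ⟨h _ (by omega) (by omega), h _ (by omega) (by omega), Or.inl ?_⟩
    unfold adjA; omega

lemma reach_down (J : Finset ℕ) (x n : ℕ) (h : ∀ z, x ≤ z → z ≤ x + n → z ∈ J) :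
    Relation.ReflTransGen (fun a b => a ∈ J ∧ b ∈ J ∧ (adjA a b ∨ adjA b a)) (x+n) x := by
  induction n with
  | zero => exact Relation.ReflTransGen.refl
  | succ n ih =>
    refine Relation.ReflTransGen.head ⟨h _ (by omega) (by omega), h _ (by omega) (by omega), Or.inr ?_⟩ (ih fun z h1 h2 => h z h1 (by omega))
    unfold adjA; omega

lemma reach_iff (J : Finset ℕ) (x y : ℕ) (hx : x ∈ J) :
    Relation.ReflTransGen (fun a b => a ∈ J ∧ b ∈ J ∧ (adjA a b ∨ adjA b a)) x y ↔
      ∀ z, min x y ≤ z → z ≤ max x y → z ∈ J := by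
  constructor
  · intro h
    induction h with
    | refl => intro z h1 h2; obtain rfl : z = x := by omega
              exact hx
    | @tail b c hb hbc ih =>
      obtain ⟨h1, h2, h3⟩ := hbc
      intro z hz1 hz2
      by_cases hzc : z = c
      · rw [hzc]; exact h2
      · apply ih <;> (unfold adjA at h3; omega)
  · intro h
    rcases le_total x y with hxy | hxy
    · obtain ⟨n, rfl⟩ := Nat.exists_eq_add_of_le hxy
      exact reach_up J x n fun z h1 h2 => h z (by omega) (by omega)
    · obtain ⟨n, rfl⟩ := Nat.exists_eq_add_of_le hxy
      exact reach_down J y n fun z h1 h2 => h z (by omega) (by omega)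

lemma exists_end (J : Finset ℕ) (x : ℕ) (hx : x ∈ J) :
    ∃ e ∈ ends J, x ≤ e ∧ ∀ z, x ≤ z → z ≤ e → z ∈ J := by
  have hex : ∃ n, x + n + 1 ∉ J := by
    refine ⟨J.sup id, fun h => ?_⟩
    have := Finset.le_sup (f := id) h
    simp only [id] at this
    omega
  have hs := Nat.find_spec hex
  have hm : ∀ z, x ≤ z → z ≤ x + Nat.find hex → z ∈ J := by
    intro z h1 h2
    rcases Nat.eq_or_lt_of_le h1 with h | h
    · rw [← h]; exact hx
    · have := Nat.find_min hex (m := z - x - 1) (by omega)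
      rw [not_not] at this
      convert this using 1
      omega
  exact ⟨x + Nat.find hex, by
    rw [ends, Finset.mem_filter]; exact ⟨hm _ (by omega) le_rfl, hs⟩, by omega, hm⟩

lemma components_eq (J : Finset ℕ) : componentsOf adjA J = (ends J).image (blk J) := by
  have h0 : componentsOf adjA J = J.image (blk J) := by
    unfold componentsOf
    apply Finset.image_congr
    intro x hx
    unfold blk
    apply Finset.filter_congr
    intro y _
    exact reach_iff J x y hx
  rw [h0]
  ext B
  simp only [Finset.mem_image]
  constructor
  · rintro ⟨x, hx, rfl⟩
    obtain ⟨e, he, hxe, hz⟩ := exists_end J x hx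
    refine ⟨e, he, ?_⟩
    ext y
    simp only [blk, Finset.mem_filter]
    refine and_congr_right fun hy => ⟨fun h z h1 h2 => ?_, fun h z h1 h2 => ?_⟩
    · by_cases hzz : x ≤ z ∧ z ≤ e
      · exact hz z hzz.1 hzz.2
      · apply h <;> omega
    · by_cases hzz : x ≤ z ∧ z ≤ e
      · exact hz z hzz.1 hzz.2
      · apply h <;> omega
  · rintro ⟨x, hx, rfl⟩
    exact ⟨x, (Finset.mem_filter.1 hx).1, rfl⟩

lemma blk_inj (J : Finset ℕ) : Set.InjOn (blk J) (ends J : Set ℕ) := by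
  intro x hx y hy h
  have hx := Finset.mem_filter.1 (Finset.mem_coe.1 hx)
  have hy := Finset.mem_filter.1 (Finset.mem_coe.1 hy)
  have h1 : x ∈ blk J x := by
    rw [blk, Finset.mem_filter]
    refine ⟨hx.1, fun z h1 h2 => ?_⟩
    obtain rfl : z = x := by omega
    exact hx.1
  rw [h, blk, Finset.mem_filter] at h1
  rcases lt_trichotomy x y with hl | hl | hl
  · exact absurd (h1.2 (x+1) (by omega) (by omega)) hx.2
  · exact hl
  · exact absurd (h1.2 (y+1) (by omega) (by omega)) hy.2

lemma kA_eq (J : Finset ℕ) : kA J = (ends J).card := by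
  rw [kA, components_eq, Finset.card_image_of_injOn (blk_inj J)]

lemma degA_eq (J : Finset ℕ) : degA J = ∑ e ∈ ends J, ((blk J e).card + 1).choose 2 := by
  rw [degA, components_eq, Finset.sum_image (blk_inj J)]

lemma blk_empty (J : Finset ℕ) (x : ℕ) (hx : x ∉ J) : blk J x = ∅ := by
  rw [blk, Finset.filter_eq_empty_iff]
  intro y _ h
  exact hx (h x (by omega) (by omega))

lemma blk_self (J : Finset ℕ) (x : ℕ) (hx : x ∈ J) : x ∈ blk J x := by
  rw [blk, Finset.mem_filter]
  refine ⟨hx, fun z h1 h2 => ?_⟩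
  obtain rfl : z = x := by omega
  exact hx

section step
variable (l : ℕ) (J : Finset ℕ) (hJ : ∀ x ∈ J, x ≤ l)

lemma ends_insert (hJ : ∀ x ∈ J, x ≤ l) :
    ends (insert (l+1) J) = insert (l+1) ((ends J).erase l) := by
  ext x
  simp only [ends, Finset.mem_filter, Finset.mem_insert, Finset.mem_erase]
  have h1 := hJ x
  have h2 := hJ (x+1)
  constructor
  · rintro ⟨h | h, h'⟩
    · exact Or.inl h
    · refine Or.inr ⟨?_, h, ?_⟩ <;> grind
  · rintro (h | ⟨h, h', h''⟩)
    · refine ⟨Or.inl h, ?_⟩; grind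
    · refine ⟨Or.inr h', ?_⟩; grind

lemma blk_insert_top (hJ : ∀ x ∈ J, x ≤ l) :
    blk (insert (l+1) J) (l+1) = insert (l+1) (blk J l) := by
  ext y
  simp only [blk, Finset.mem_filter, Finset.mem_insert]
  constructor
  · rintro ⟨h | h, h'⟩
    · exact Or.inl h
    · have := hJ y h
      refine Or.inr ⟨h, fun z h1 h2 => ?_⟩
      rcases h' z (by omega) (by omega) with h3 | h3
      · omega
      · exact h3
  · rintro (h | ⟨h, h'⟩)
    · exact ⟨Or.inl h, fun z h1 h2 => Or.inl (by omega)⟩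
    · have := hJ y h
      refine ⟨Or.inr h, fun z h1 h2 => ?_⟩
      by_cases hz : z = l + 1
      · exact Or.inl hz
      · exact Or.inr (h' z (by omega) (by omega))

lemma blk_insert_other (hJ : ∀ x ∈ J, x ≤ l) (e : ℕ) (he : e ∈ (ends J).erase l) :
    blk (insert (l+1) J) e = blk J e := by
  simp only [ends, Finset.mem_filter, Finset.mem_erase] at he
  obtain ⟨h1, h2, h3⟩ := he
  have h4 := hJ e h2
  ext y
  simp only [blk, Finset.mem_filter, Finset.mem_insert]
  constructor
  · rintro ⟨h, h'⟩
    have hy : y ≤ e := by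
      by_contra hc
      rcases h' (e+1) (by omega) (by omega) with h5 | h5
      · omega
      · exact h3 h5
    refine ⟨by rcases h with h | h; omega; exact h, fun z hz1 hz2 => ?_⟩
    rcases h' z hz1 hz2 with h5 | h5
    · omega
    · exact h5
  · rintro ⟨h, h'⟩
    exact ⟨Or.inr h, fun z hz1 hz2 => Or.inr (h' z hz1 hz2)⟩

lemma top_card (hJ : ∀ x ∈ J, x ≤ l) :
    (blk (insert (l+1) J) (l+1)).card = (blk J l).card + 1 := by
  rw [blk_insert_top l J hJ, Finset.card_insert_of_notMem]
  intro h
  have := hJ _ (Finset.mem_filter.1 h).1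
  omega

lemma notMem_erase (hJ : ∀ x ∈ J, x ≤ l) : l + 1 ∉ (ends J).erase l := by
  intro h
  have := hJ _ (Finset.mem_filter.1 (Finset.mem_of_mem_erase h)).1
  omega

lemma mem_ends (hJ : ∀ x ∈ J, x ≤ l) : l ∈ ends J ↔ l ∈ J := by
  rw [ends, Finset.mem_filter]
  refine ⟨fun h => h.1, fun h => ⟨h, fun h' => ?_⟩⟩
  have := hJ _ h'
  omega

lemma card_blk_zero : (blk J l).card = 0 ↔ l ∉ J := by
  constructor
  · intro h hl
    rw [Finset.card_eq_zero] at h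
    have := blk_self J l hl
    rw [h] at this
    simp at this
  · intro h
    rw [blk_empty J l h]; rfl

lemma kA_insert (hJ : ∀ x ∈ J, x ≤ l) :
    kA (insert (l+1) J) = kA J + if (blk J l).card = 0 then 1 else 0 := by
  rw [kA_eq, kA_eq, ends_insert l J hJ, Finset.card_insert_of_notMem (notMem_erase l J hJ)]
  by_cases h : l ∈ J
  · rw [if_neg (by rw [card_blk_zero]; simpa using h)]
    exact Finset.card_erase_add_one ((mem_ends l J hJ).2 h)
  · rw [if_pos ((card_blk_zero l J).2 h), Finset.erase_eq_of_notMem]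
    rwa [mem_ends l J hJ]

lemma degA_insert (hJ : ∀ x ∈ J, x ≤ l) :
    degA (insert (l+1) J) = degA J + (blk J l).card + 1 := by
  rw [degA_eq, degA_eq, ends_insert l J hJ, Finset.sum_insert (notMem_erase l J hJ),
    top_card l J hJ]
  have e : ∑ e ∈ (ends J).erase l, ((blk (insert (l+1) J) e).card + 1).choose 2
      = ∑ e ∈ (ends J).erase l, ((blk J e).card + 1).choose 2 :=
    Finset.sum_congr rfl fun e he => by rw [blk_insert_other l J hJ e he]
  rw [e, Nat.choose_succ_succ ((blk J l).card + 1) 1, Nat.choose_one_right]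
  by_cases h : l ∈ J
  · rw [← Finset.sum_erase_add _ _ ((mem_ends l J hJ).2 h)]; simp only [Nat.succ_eq_add_one, Nat.reduceAdd]; omega
  · rw [(card_blk_zero l J).2 h, Finset.erase_eq_of_notMem (by rwa [mem_ends l J hJ])]
    simp; omega

end step

lemma sum_eq_G (l : ℕ) : ∀ f : ℕ → ℕ → ℕ → ℕ → ℕ → ℕ,
    ∑ J ∈ (Finset.Icc 1 l).powerset, f J.card (l - J.card) (kA J) (blk J l).card (degA J)
      = G l f := by
  induction l with
  | zero => intro f; simp [G, kA, degA, componentsOf, blk]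
  | succ l ih =>
    intro f
    rw [G, ← ih, ← Finset.insert_Icc_right_eq_Icc_add_one (by omega),
      Finset.sum_powerset_insert (by simp), ← Finset.sum_add_distrib]
    apply Finset.sum_congr rfl
    intro J hJ
    rw [Finset.mem_powerset] at hJ
    have hJ' : ∀ x ∈ J, x ≤ l := fun x hx => (Finset.mem_Icc.1 (hJ hx)).2
    have hn : l + 1 ∉ J := fun h => by have := hJ' _ h; omega
    have hc : J.card ≤ l := by simpa using Finset.card_le_card hJ
    rw [(card_blk_zero (l+1) J).2 hn, kA_insert l J hJ', degA_insert l J hJ', top_card l J hJ',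
      Finset.card_insert_of_notMem hn, show l + 1 - J.card = l - J.card + 1 by omega,
      show l + 1 - (J.card + 1) = l - J.card by omega]

end DegAProof

/-- For positive integers `l, j, k` with `j ≤ l` and `k ≤ min(j, l - j + 1)`, the sum of
`deg_A(J)` over all subsets `J ⊆ {1,…,l}` with `#J = j` whose decomposition into maximal
blocks of consecutive integers has exactly `k` blocks equals
`k · binom(j + 1, k + 1) · binom(l - j + 1, k)`. -/
theorem sum_degA_fixed_components (l j k : ℕ) (hj : 1 ≤ j) (hjl : j ≤ l)
    (hk : 1 ≤ k) (hk' : k ≤ min j (l - j + 1)) :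
    ∑ J ∈ (Finset.Icc 1 l).powerset.filter (fun J => J.card = j ∧ kA J = k), degA J
      = k * (j + 1).choose (k + 1) * (l - j + 1).choose k := by
  obtain ⟨m, rfl⟩ := Nat.exists_eq_add_of_le hjl
  rw [show j + m - j + 1 = m + 1 by omega, ← DegAProof.closed_total, ← DegAProof.sum_eq_G,
    Finset.sum_filter]
  apply Finset.sum_congr rfl
  intro J _
  apply if_congr _ rfl rfl
  constructor
  · rintro ⟨h1, h2⟩
    exact ⟨h1, by omega, h2⟩
  · rintro ⟨h1, _, h2⟩
    exact ⟨h1, h2⟩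
end

section
/- For every integer l ≥ 2, N'_{B_l}(1) − N'_{A_l}(1) = (-1)^l · (l - 1), where N'_{B_l}(1) = Σ_{J ⊆ {1,...,l}} (-1)^{#J} deg_B(J) and N'_{A_l}(1) = Σ_{J ⊆ {1,...,l}} (-1)^{#J} deg_A(J). -/
open scoped Classical

def relA (J : Finset ℕ) (a b : ℕ) : Prop := a ∈ J ∧ b ∈ J ∧ (adjA a b ∨ adjA b a)

theorem relA_symm (J : Finset ℕ) {x y : ℕ} (h : Relation.ReflTransGen (relA J) x y) :
    Relation.ReflTransGen (relA J) y x := by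
  induction h with
  | refl => exact .refl
  | tail _ h2 ih => exact .head ⟨h2.2.1, h2.1, h2.2.2.symm⟩ ih

theorem relA_one (J : Finset ℕ) (h0 : 0 ∉ J) (h1 : 1 ∈ J) (y : ℕ) :
    Relation.ReflTransGen (relA J) 1 y ↔ 1 ≤ y ∧ Finset.Icc 1 y ⊆ J := by
  constructor
  · intro h
    induction h with
    | refl => simpa using h1
    | @tail b c _ h2 ih =>
      obtain ⟨hb, hc, h⟩ := h2
      have hc0 : c ≠ 0 := fun h => h0 (h ▸ hc)
      refine ⟨by omega, fun x hx => ?_⟩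
      rw [Finset.mem_Icc] at hx
      by_cases hxc : x = c
      · exact hxc ▸ hc
      · apply ih.2
        rw [Finset.mem_Icc]
        unfold adjA at h
        omega
  · rintro ⟨hy, hs⟩
    induction y, hy using Nat.le_induction with
    | base => exact .refl
    | succ n hn ih =>
      refine .tail (ih fun x hx => hs ?_) ⟨hs ?_, hs ?_, Or.inl rfl⟩ <;>
        simp only [Finset.mem_Icc] at * <;> omega

theorem gauss_icc (m : ℕ) : ∑ j ∈ Finset.Icc 1 m, ((j : ℤ) - 1) = (m.choose 2 : ℕ) := by
  induction m with
  | zero => simp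
  | succ n ih =>
    rw [Finset.sum_Icc_succ_top (by omega), ih, Nat.choose_succ_succ' n 1]
    push_cast
    simp
    ring

theorem sq_choose (m : ℕ) : m ^ 2 = (m + 1).choose 2 + m.choose 2 := by
  induction m with
  | zero => rfl
  | succ n ih =>
    rw [Nat.choose_succ_succ' (n+1) 1, Nat.choose_succ_succ' n 1] at *
    simp only [Nat.choose_one_right] at *
    nlinarith

theorem sum_down (C : Finset ℕ) (h0 : 0 ∉ C) (hd : ∀ y ∈ C, Finset.Icc 1 y ⊆ C) :
    ∑ j ∈ C, ((j : ℤ) - 1) = (C.card.choose 2 : ℕ) := by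
  have hC : ∃ m, C = Finset.Icc 1 m := by
    refine ⟨C.sup id, ?_⟩
    ext x
    rw [Finset.mem_Icc]
    constructor
    · intro hx
      have : x ≠ 0 := fun h => h0 (h ▸ hx)
      exact ⟨by omega, Finset.le_sup (f := id) hx⟩
    · rintro ⟨h1, h2⟩
      have hne : C.Nonempty := by
        by_contra hn
        rw [Finset.not_nonempty_iff_eq_empty] at hn
        subst hn
        simp at h2
        omega
      obtain ⟨y, hy, hys⟩ := Finset.exists_mem_eq_sup C hne id
      rw [hys] at h2
      exact hd y hy (Finset.mem_Icc.2 ⟨h1, h2⟩)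
  obtain ⟨m, rfl⟩ := hC
  rw [gauss_icc]
  simp

theorem degB_eq (l : ℕ) (J : Finset ℕ) (hJ : J ⊆ Finset.Icc 1 l) :
    (degB J : ℤ) = degA J +
      ∑ j ∈ Finset.Icc 1 l, if Finset.Icc 1 j ⊆ J then ((j : ℤ) - 1) else 0 := by
  have h0 : 0 ∉ J := fun h => by simpa using hJ h
  have hB : degB J = degA J +
      ∑ B ∈ componentsOf adjA J, if 1 ∈ B ∧ 2 ∈ B then B.card.choose 2 else 0 := by
    unfold degB degA
    rw [← Finset.sum_add_distrib]
    refine Finset.sum_congr rfl fun B _ => ?_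
    split_ifs
    · exact sq_choose _
    · rfl
  rw [hB]
  push_cast
  congr 1
  have hmem : ∀ B, B ∈ componentsOf adjA J ↔
      ∃ x ∈ J, J.filter (fun y => Relation.ReflTransGen (relA J) x y) = B := by
    intro B
    unfold componentsOf relA
    rw [Finset.mem_image]
  by_cases h1 : 1 ∈ J
  · set C := J.filter (fun y => Relation.ReflTransGen (relA J) 1 y) with hC
    have hCm : ∀ y, y ∈ C ↔ 1 ≤ y ∧ Finset.Icc 1 y ⊆ J := by
      intro y
      rw [hC, Finset.mem_filter, relA_one J h0 h1]
      exact ⟨fun h => h.2, fun h => ⟨h.2 (Finset.mem_Icc.2 ⟨h.1, le_rfl⟩), h⟩⟩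
    have hC1 : 1 ∈ C := by rw [hCm]; simpa using h1
    have hd : ∀ y ∈ C, Finset.Icc 1 y ⊆ C := by
      intro y hy x hx
      rw [hCm] at hy ⊢
      rw [Finset.mem_Icc] at hx
      exact ⟨hx.1, (Finset.Icc_subset_Icc le_rfl hx.2).trans hy.2⟩
    rw [Finset.sum_eq_single C]
    · have e : (Finset.Icc 1 l).filter (fun j => Finset.Icc 1 j ⊆ J) = C := by
        ext y
        rw [Finset.mem_filter, hCm, Finset.mem_Icc]
        refine ⟨fun h => ⟨h.1.1, h.2⟩, fun h => ⟨?_, h.2⟩⟩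
        exact Finset.mem_Icc.1 (hJ (h.2 (Finset.mem_Icc.2 ⟨h.1, le_rfl⟩)))
      rw [← Finset.sum_filter, e, sum_down C (by simp [hCm]) hd]
      by_cases h2 : 2 ∈ C
      · simp [hC1, h2]
      · have : C = {1} := by
          ext y
          rw [Finset.mem_singleton]
          constructor
          · intro hy
            have := (hCm y).1 hy
            by_contra hne
            exact h2 (hd y hy (Finset.mem_Icc.2 ⟨by omega, by omega⟩))
          · rintro rfl; exact hC1
        rw [this]
        simp
    · intro B hB hne
      rw [if_neg]
      rintro ⟨hb, -⟩
      apply hne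
      obtain ⟨x, hx, rfl⟩ := (hmem B).1 hB
      rw [Finset.mem_filter] at hb
      rw [hC]
      refine Finset.filter_congr fun y _ => ?_
      exact ⟨fun h => (relA_symm J hb.2).trans h, fun h => hb.2.trans h⟩
    · intro h
      exact absurd ((hmem C).2 ⟨1, h1, rfl⟩) h
  · rw [Finset.sum_eq_zero, Finset.sum_eq_zero]
    · intro j hj
      rw [if_neg]
      intro h
      exact h1 (h (Finset.mem_Icc.2 ⟨le_rfl, (Finset.mem_Icc.1 hj).1⟩))
    · intro B hB
      rw [if_neg]
      rintro ⟨hb, -⟩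
      obtain ⟨x, hx, rfl⟩ := (hmem B).1 hB
      exact h1 (Finset.mem_filter.1 hb).1

theorem signed_sum (n j : ℕ) (hj : j ≤ n) :
    ∑ J ∈ (Finset.Icc 1 (n+1)).powerset,
      (if Finset.Icc 1 j ⊆ J then (-1 : ℤ) ^ J.card else 0) = 0 := by
  have e : Finset.Icc 1 (n+1) = insert (n+1) (Finset.Icc 1 n) := by
    ext x; simp only [Finset.mem_Icc, Finset.mem_insert]; omega
  rw [e, Finset.sum_powerset_insert (by simp), ← Finset.sum_add_distrib]
  refine Finset.sum_eq_zero fun J hJ => ?_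
  have hn : n + 1 ∉ J := fun h => by
    have := Finset.mem_powerset.1 hJ h
    simp at this
  have hs : Finset.Icc 1 j ⊆ insert (n + 1) J ↔ Finset.Icc 1 j ⊆ J :=
    Finset.subset_insert_iff_of_notMem (by simp; omega)
  rw [Finset.card_insert_of_notMem hn]
  simp only [hs]
  split_ifs
  · ring
  · rfl

/-- For every integer `l ≥ 2`, `N'_{B_l}(1) − N'_{A_l}(1) = (-1)^l · (l - 1)`. -/
theorem deriv_one_typeB_sub_typeA (l : ℕ) (hl : 2 ≤ l) :
    (∑ J ∈ (Finset.Icc 1 l).powerset, (-1 : ℤ) ^ J.card * (degB J : ℤ)) -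
      (∑ J ∈ (Finset.Icc 1 l).powerset, (-1 : ℤ) ^ J.card * (degA J : ℤ))
      = (-1) ^ l * ((l : ℤ) - 1) := by
  obtain ⟨n, rfl⟩ : ∃ n, l = n + 1 := ⟨l - 1, by omega⟩
  have h : ∀ J ∈ (Finset.Icc 1 (n+1)).powerset,
      (-1 : ℤ) ^ J.card * (degB J : ℤ) - (-1 : ℤ) ^ J.card * (degA J : ℤ) =
      ∑ j ∈ Finset.Icc 1 (n+1), ((j : ℤ) - 1) *
        (if Finset.Icc 1 j ⊆ J then (-1 : ℤ) ^ J.card else 0) := by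
    intro J hJ
    rw [degB_eq (n+1) J (Finset.mem_powerset.1 hJ), mul_add, add_sub_cancel_left,
      Finset.mul_sum]
    refine Finset.sum_congr rfl fun j _ => ?_
    split_ifs
    · ring
    · ring
  rw [← Finset.sum_sub_distrib, Finset.sum_congr rfl h, Finset.sum_comm]
  simp_rw [← Finset.mul_sum]
  rw [Finset.sum_eq_single (n+1)]
  · rw [Finset.sum_eq_single (Finset.Icc 1 (n+1))]
    · simp
      ring
    · intro J hJ hne
      rw [if_neg]
      exact fun h => hne ((Finset.mem_powerset.1 hJ).antisymm h)
    · simp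
  · intro j hj hne
    rw [signed_sum n j (by have := Finset.mem_Icc.1 hj; omega), mul_zero]
  · intro h
    simp at h
end
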